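/- arXiv:2011.14571 — 2 statements merged into one kernel-verified Lean document; each statement's English description precedes it below -/
import Mathlib

section
/- Suppose M, σ, r, l are positive real constants with rσ² ≥ M². Define U(q) = q·(M/r − (M/r − (1−p)l/p)·((1−p)/p)^a·(q/(1−q))^a) for q ∈ (0,p). Then U satisfies −r·U(q) + (M²q²(1−q)²/(2σ²))·U''(q) + M·q = 0 for all q ∈ (0,p); moreover U(q) → 0 as q → 0⁺, U(q) → l(1−p) as q → p⁻, and U'(q) → −l as q → p⁻. -/
lemma hasDerivAt_odds_rpow (a : ℝ) {q : ℝ} (h0 : 0 < q) (h1 : q < 1) :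
    HasDerivAt (fun x : ℝ => (x / (1 - x)) ^ a) (a * (q / (1 - q)) ^ a / (q * (1 - q))) q := by
  have h1' : 0 < 1 - q := sub_pos.2 h1
  have hodds : HasDerivAt (fun x : ℝ => x / (1 - x)) (1 / (1 - q) ^ 2) q := by
    refine ((hasDerivAt_id q).div ((hasDerivAt_id q).const_sub 1) h1'.ne').congr_deriv ?_
    simp
  have hpos : 0 < q / (1 - q) := div_pos h0 h1'
  refine (hodds.rpow_const (p := a) (Or.inl hpos.ne')).congr_deriv ?_
  rw [Real.rpow_sub_one hpos.ne']
  field_simp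

lemma hasDerivAt_mul_odds_rpow (a A K : ℝ) {q : ℝ} (h0 : 0 < q) (h1 : q < 1) :
    HasDerivAt (fun x : ℝ => x * (A - K * (x / (1 - x)) ^ a))
      (A - K * ((q / (1 - q)) ^ a * (1 + a / (1 - q)))) q := by
  have h1' : 1 - q ≠ 0 := (sub_pos.2 h1).ne'
  refine ((hasDerivAt_id q).mul
    (((hasDerivAt_odds_rpow a h0 h1).const_mul K).const_sub A)).congr_deriv ?_
  simp only [id]
  field_simp
  ring

lemma hasDerivAt_deriv_mul_odds_rpow (a A K : ℝ) {q : ℝ} (h0 : 0 < q) (h1 : q < 1) :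
    HasDerivAt (fun x : ℝ => A - K * ((x / (1 - x)) ^ a * (1 + a / (1 - x))))
      (-(K * (a * (a + 1) * (q / (1 - q)) ^ a / (q * (1 - q) ^ 2)))) q := by
  have h1' : 1 - q ≠ 0 := (sub_pos.2 h1).ne'
  have hinv : HasDerivAt (fun x : ℝ => 1 + a / (1 - x)) (a / (1 - q) ^ 2) q := by
    refine (((hasDerivAt_const q a).div ((hasDerivAt_id q).const_sub 1) h1').const_add
      1).congr_deriv ?_
    simp
  refine ((((hasDerivAt_odds_rpow a h0 h1).mul hinv).const_mul K).const_sub A).congr_deriv ?_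
  field_simp
  ring

/-- In the regime `rσ² ≥ M²`, with `p = (1+a)rl/((1+a)rl + aM)`, the function
`U(q) = q(M/r − (M/r − (1−p)l/p)((1−p)/p)^a (q/(1−q))^a)` satisfies
`−rU(q) + (M²q²(1−q)²/(2σ²))U''(q) + Mq = 0` on `(0,p)`, with `U(q) → 0` as `q → 0⁺`,
`U(q) → l(1−p)` as `q → p⁻`, and `U'(q) → −l` as `q → p⁻`. -/
theorem stmt_6 (M σ r l : ℝ) (hM : 0 < M) (hσ : 0 < σ) (hr : 0 < r) (hl : 0 < l)
    (hreg : M ^ 2 ≤ r * σ ^ 2) (a p : ℝ)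
    (ha : a = (1 / 2) * (Real.sqrt (1 + 8 * r * σ ^ 2 / M ^ 2) - 1))
    (hp : p = (1 + a) * r * l / ((1 + a) * r * l + a * M))
    (U : ℝ → ℝ)
    (hU : ∀ q, U q = q * (M / r
      - (M / r - (1 - p) * l / p) * ((1 - p) / p) ^ a * (q / (1 - q)) ^ a)) :
    (∀ q ∈ Set.Ioo (0:ℝ) p,
      -r * U q + (M ^ 2 * q ^ 2 * (1 - q) ^ 2 / (2 * σ ^ 2)) * deriv (deriv U) q
        + M * q = 0) ∧
    Filter.Tendsto U (nhdsWithin 0 (Set.Ioi 0)) (nhds 0) ∧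
    Filter.Tendsto U (nhdsWithin p (Set.Iio p)) (nhds (l * (1 - p))) ∧
    Filter.Tendsto (deriv U) (nhdsWithin p (Set.Iio p)) (nhds (-l)) := by
  have hm : 0 < 8 * r * σ ^ 2 / M ^ 2 := by positivity
  have ha0 : 0 < a := by
    have : 1 < Real.sqrt (1 + 8 * r * σ ^ 2 / M ^ 2) := by
      rw [Real.lt_sqrt zero_le_one]
      linarith
    rw [ha]
    linarith
  have haa : a * (a + 1) * M ^ 2 = 2 * r * σ ^ 2 := by
    have hs := Real.sq_sqrt (by linarith : 0 ≤ 1 + 8 * r * σ ^ 2 / M ^ 2)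
    have : a * (a + 1) = 2 * r * σ ^ 2 / M ^ 2 := by
      rw [ha]
      linear_combination hs / 4
    rw [this]
    field_simp
  have hp0 : 0 < p := by
    rw [hp]
    positivity
  have hp1 : p < 1 := by
    rw [hp, div_lt_one (by positivity)]
    linarith [mul_pos ha0 hM]
  have hp1' : 0 < 1 - p := sub_pos.2 hp1
  have hsmooth_fit : (1 + a) * r * l * (1 - p) = a * M * p := by
    have hD : (1 + a) * r * l + a * M ≠ 0 := by positivity
    have := (eq_div_iff hD).1 hp
    linear_combination -this
  have hone : ((1 - p) / p) ^ a * (p / (1 - p)) ^ a = 1 := by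
    rw [← Real.mul_rpow (by positivity) (by positivity),
      show (1 - p) / p * (p / (1 - p)) = 1 by field_simp, Real.one_rpow]
  obtain rfl : U = _ := funext hU
  set A := M / r with hA
  set K := (A - (1 - p) * l / p) * ((1 - p) / p) ^ a with hK
  have hKp : K * (p / (1 - p)) ^ a = A - (1 - p) * l / p := by
    rw [hK, mul_assoc, hone, mul_one]
  have hderiv : ∀ q ∈ Set.Ioo (0 : ℝ) 1,
      deriv (fun x : ℝ => x * (A - K * (x / (1 - x)) ^ a)) q
        = A - K * ((q / (1 - q)) ^ a * (1 + a / (1 - q))) :=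
    fun q hq => (hasDerivAt_mul_odds_rpow a A K hq.1 hq.2).deriv
  refine ⟨fun q hq => ?_, ?_, ?_, ?_⟩
  · have hq1 : q < 1 := hq.2.trans hp1
    have hq0 : q ≠ 0 := hq.1.ne'
    have hq1' : 1 - q ≠ 0 := (sub_pos.2 hq1).ne'
    have hev : deriv (fun x : ℝ => x * (A - K * (x / (1 - x)) ^ a)) =ᶠ[nhds q]
        fun x => A - K * ((x / (1 - x)) ^ a * (1 + a / (1 - x))) := by
      filter_upwards [Ioo_mem_nhds hq.1 hq1] with x hx using hderiv x hx
    rw [hev.deriv_eq, (hasDerivAt_deriv_mul_odds_rpow a A K hq.1 hq1).deriv]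
    have hAr : r * A = M := by rw [hA]; field_simp
    beta_reduce
    generalize (q / (1 - q)) ^ a = g
    have hcoef : M ^ 2 * q ^ 2 * (1 - q) ^ 2 / (2 * σ ^ 2)
        * -(K * (a * (a + 1) * g / (q * (1 - q) ^ 2))) = -(r * q * K * g) := by
      field_simp
      linear_combination (-K * g) * haa
    rw [hcoef]
    linear_combination (-q) * hAr
  · have hc : ContinuousAt (fun x : ℝ => x * (A - K * (x / (1 - x)) ^ a)) 0 := by
      have : ContinuousAt (fun x : ℝ => x / (1 - x)) 0 :=
        continuousAt_id.div (continuousAt_const.sub continuousAt_id) (by norm_num)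
      exact continuousAt_id.mul
        (continuousAt_const.sub (continuousAt_const.mul (this.rpow_const (Or.inr ha0.le))))
    have := hc.tendsto
    rw [zero_mul] at this
    exact this.mono_left nhdsWithin_le_nhds
  · have := (hasDerivAt_mul_odds_rpow a A K hp0 hp1).continuousAt.tendsto
    rw [hKp, show p * (A - (A - (1 - p) * l / p)) = l * (1 - p) by field_simp; ring] at this
    exact this.mono_left nhdsWithin_le_nhds
  · have hlim := (hasDerivAt_deriv_mul_odds_rpow a A K hp0 hp1).continuousAt.tendsto
    have hval : A - K * ((p / (1 - p)) ^ a * (1 + a / (1 - p))) = -l := by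
      rw [← mul_assoc, hKp, hA]
      field_simp
      linear_combination hsmooth_fit
    rw [hval] at hlim
    refine (hlim.mono_left nhdsWithin_le_nhds).congr' ?_
    filter_upwards [Ioo_mem_nhdsLT hp0] with x hx
    exact (hderiv x ⟨hx.1, hx.2.trans hp1⟩).symm
end

section
/- Suppose M, σ, r, l are positive real constants with rσ² < M². Let y : (q*, p) → ℝ be a twice differentiable function satisfying φ(y(q)) = c(p − q)/(p(1 − q)) for all q ∈ (q*, p). Define α(q) = (2p(1−q)σ√r/(c√π(1−p)q))·e^{−y(q)²} and U(q) = (σ/√r)·q·y(q) + l(1−q)·(e^{−y(q)²} − (c√π(1−p)q/(p(1−q)))·y(q)) for q ∈ (q*, p). Then U satisfies −r·U(q) + (q²(1−q)²·α(q)²/(2σ²))·U''(q) + q·α(q) = 0 for all q ∈ (q*, p); moreover U(q) → l(1−p) as q → p⁻ and U'(q) → −l as q → p⁻. -/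
/-- The Gauss error function `erf x = (2/√π) ∫₀ˣ e^{−t²} dt`. -/
noncomputable def erf (x : ℝ) : ℝ :=
  (2 / Real.sqrt Real.pi) * ∫ t in (0:ℝ)..x, Real.exp (-t ^ 2)

theorem hasDerivAt_erf (x : ℝ) :
    HasDerivAt erf (2 / Real.sqrt Real.pi * Real.exp (-x ^ 2)) x := by
  have hcont : Continuous fun t : ℝ => Real.exp (-t ^ 2) := by fun_prop
  exact (hcont.integral_hasStrictDerivAt 0 x).hasDerivAt.const_mul (2 / Real.sqrt Real.pi)

theorem erf_strictMono : StrictMono erf := by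
  refine strictMono_of_hasDerivAt_pos hasDerivAt_erf fun x => ?_
  have := Real.pi_pos
  positivity

theorem erf_zero : erf 0 = 0 := by simp [erf]

theorem tendsto_zero_of_tendsto_erf {ι : Type*} {f : Filter ι} {y : ι → ℝ}
    (h : Filter.Tendsto (fun i => erf (y i)) f (nhds 0)) : Filter.Tendsto y f (nhds 0) := by
  rw [← erf_zero] at h
  obtain ⟨hlow, hup⟩ := tendsto_order.1 h
  refine tendsto_order.2 ⟨fun u hu => ?_, fun u hu => ?_⟩
  · filter_upwards [hlow _ (erf_strictMono hu)] with i hi using erf_strictMono.lt_iff_lt.1 hi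
  · filter_upwards [hup _ (erf_strictMono hu)] with i hi using erf_strictMono.lt_iff_lt.1 hi

/-- The derivative of a solution of `erf (y q) = c (p - q) / (p (1 - q))`. -/
theorem deriv_eq_of_erf_eq {c p q : ℝ} {y : ℝ → ℝ} (hp : p ≠ 0) (hq : 1 - q ≠ 0)
    (hy : DifferentiableAt ℝ y q)
    (h : (fun x => erf (y x)) =ᶠ[nhds q] fun x => c * (p - x) / (p * (1 - x))) :
    deriv y q = -(Real.sqrt Real.pi * c * (1 - p) / p) / 2 * Real.exp ((y q) ^ 2)
      / (1 - q) ^ 2 := by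
  have h1 := (hasDerivAt_erf (y q)).comp q hy.hasDerivAt
  have h2 : HasDerivAt (fun x => c * (p - x) / (p * (1 - x)))
      ((c * (-1) * (p * (1 - q)) - c * (p - q) * (p * (-1))) / (p * (1 - q)) ^ 2) q :=
    (((hasDerivAt_id q).const_sub p).const_mul c).div
      (((hasDerivAt_id q).const_sub 1).const_mul p) (mul_ne_zero hp hq)
  have h3 := h1.unique (h2.congr_of_eventuallyEq h)
  have hs : Real.sqrt Real.pi ≠ 0 := (Real.sqrt_pos.2 Real.pi_pos).ne'
  rw [Real.exp_neg] at h3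
  have he := (Real.exp_pos ((y q) ^ 2)).ne'
  field_simp at h3 ⊢
  linear_combination h3

theorem threshold_pos {M σ r a b : ℝ} (hM : 0 < M) (hσ : 0 < σ) (hr : 0 < r)
    (hreg : r * σ ^ 2 < M ^ 2)
    (ha : a = (1 / 2) * (Real.sqrt (1 + 8 * r * σ ^ 2 / M ^ 2) - 1))
    (hb : b = (1 - a) * M / (2 * σ * Real.sqrt r)) : 0 < b := by
  have hsr : 0 < Real.sqrt r := Real.sqrt_pos.2 hr
  have hlt : Real.sqrt (1 + 8 * r * σ ^ 2 / M ^ 2) < 3 := by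
    rw [Real.sqrt_lt' (by norm_num)]
    have : 8 * r * σ ^ 2 / M ^ 2 < 8 := by
      rw [div_lt_iff₀ (by positivity)]
      linarith
    linarith
  have : 0 < 1 - a := by rw [ha]; linarith
  rw [hb]
  positivity

/-- In the regime `rσ² < M²`, with `y` twice differentiable on `(q*,p)`
satisfying `φ(y(q)) = c(p−q)/(p(1−q))`, the functions
`α(q) = (2p(1−q)σ√r/(c√π(1−p)q)) e^{−y(q)²}` and
`U(q) = (σ/√r) q y(q) + l(1−q)(e^{−y(q)²} − (c√π(1−p)q/(p(1−q))) y(q))` satisfy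
`−rU + (q²(1−q)²α²/(2σ²))U'' + qα = 0` on `(q*,p)`, with `U(q) → l(1−p)` and
`U'(q) → −l` as `q → p⁻`. -/
theorem stmt_11 (M σ r l : ℝ) (hM : 0 < M) (hσ : 0 < σ) (hr : 0 < r) (hl : 0 < l)
    (hreg : r * σ ^ 2 < M ^ 2) (a b c p qstar : ℝ)
    (ha : a = (1 / 2) * (Real.sqrt (1 + 8 * r * σ ^ 2 / M ^ 2) - 1))
    (hb : b = (1 - a) * M / (2 * σ * Real.sqrt r))
    (hc : c = (2 * σ * Real.sqrt r * Real.exp (-b ^ 2)) / (M * Real.sqrt Real.pi) + erf b)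
    (hp : p = c * l * Real.sqrt (Real.pi * r) / (c * l * Real.sqrt (Real.pi * r) + σ))
    (hqs : qstar = p * (c - erf b) / (c - p * erf b))
    (y : ℝ → ℝ)
    (hy1 : ∀ q ∈ Set.Ioo qstar p, DifferentiableAt ℝ y q)
    (hy2 : ∀ q ∈ Set.Ioo qstar p, DifferentiableAt ℝ (deriv y) q)
    (herf : ∀ q ∈ Set.Ioo qstar p, erf (y q) = c * (p - q) / (p * (1 - q)))
    (α U : ℝ → ℝ)
    (hα : ∀ q, α q = (2 * p * (1 - q) * σ * Real.sqrt r
      / (c * Real.sqrt Real.pi * (1 - p) * q)) * Real.exp (-(y q) ^ 2))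
    (hU : ∀ q, U q = (σ / Real.sqrt r) * q * y q
      + l * (1 - q) * (Real.exp (-(y q) ^ 2)
        - (c * Real.sqrt Real.pi * (1 - p) * q / (p * (1 - q))) * y q)) :
    (∀ q ∈ Set.Ioo qstar p,
      -r * U q + (q ^ 2 * (1 - q) ^ 2 * (α q) ^ 2 / (2 * σ ^ 2)) * deriv (deriv U) q
        + q * α q = 0) ∧
    Filter.Tendsto U (nhdsWithin p (Set.Ioo qstar p)) (nhds (l * (1 - p))) ∧
    Filter.Tendsto (deriv U) (nhdsWithin p (Set.Ioo qstar p)) (nhds (-l)) := by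
  have hsr : 0 < Real.sqrt r := Real.sqrt_pos.2 hr
  have hsπ : 0 < Real.sqrt Real.pi := Real.sqrt_pos.2 Real.pi_pos
  have hsr2 : Real.sqrt r ^ 2 = r := Real.sq_sqrt hr.le
  have hb0 : 0 < b := threshold_pos hM hσ hr hreg ha hb
  have herfb : 0 < erf b := by simpa [erf_zero] using erf_strictMono hb0
  have hcb : erf b < c := by
    rw [hc]
    have : 0 < (2 * σ * Real.sqrt r * Real.exp (-b ^ 2)) / (M * Real.sqrt Real.pi) := by
      positivity
    linarith
  have hc0 : 0 < c := herfb.trans hcb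
  rw [Real.sqrt_mul Real.pi_pos.le] at hp
  have hp0 : 0 < p := by rw [hp]; positivity
  have h1p : 1 - p = σ / (c * l * (Real.sqrt Real.pi * Real.sqrt r) + σ) := by
    rw [hp]; field_simp; ring
  have hp1 : 0 < 1 - p := by rw [h1p]; positivity
  have hk : Real.sqrt Real.pi * c * (1 - p) / p = σ / (l * Real.sqrt r) := by
    rw [h1p, hp]; field_simp
  have hqs0 : 0 < qstar := by
    rw [hqs]
    have h1 : 0 < c - erf b := by linarith
    have h2 : 0 < c - p * erf b := by nlinarith
    positivity
  have hq0 : ∀ q ∈ Set.Ioo qstar p, 0 < q := fun q hq => hqs0.trans hq.1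
  have hq1 : ∀ q ∈ Set.Ioo qstar p, 0 < 1 - q := fun q hq => by linarith [hq.2]
  have hnhds : ∀ q ∈ Set.Ioo qstar p, Set.Ioo qstar p ∈ nhds q :=
    fun q hq => isOpen_Ioo.mem_nhds hq
  have hUeq : ∀ q ∈ Set.Ioo qstar p, U q = l * (1 - q) * Real.exp (-(y q) ^ 2) := by
    intro q hq
    have h := (hq1 q hq).ne'
    have hsplit : c * Real.sqrt Real.pi * (1 - p) * q / (p * (1 - q))
        = (Real.sqrt Real.pi * c * (1 - p) / p) * q / (1 - q) := by
      field_simp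
    rw [hU, hsplit, hk]
    field_simp
    ring
  have hy' : ∀ q ∈ Set.Ioo qstar p,
      deriv y q = -(σ / (l * Real.sqrt r)) / 2 * Real.exp ((y q) ^ 2) / (1 - q) ^ 2 := by
    intro q hq
    rw [← hk]
    exact deriv_eq_of_erf_eq hp0.ne' (hq1 q hq).ne' (hy1 q hq)
      (Filter.eventuallyEq_of_mem (hnhds q hq) herf)
  have hE : ∀ q ∈ Set.Ioo qstar p, HasDerivAt (fun x => Real.exp (-(y x) ^ 2))
      (Real.exp (-(y q) ^ 2) * (-(2 * y q * deriv y q))) q := by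
    intro q hq
    have h := (((hy1 q hq).hasDerivAt.pow 2).neg).exp
    simpa using h
  have hU' : ∀ q ∈ Set.Ioo qstar p,
      deriv U q = -l * Real.exp (-(y q) ^ 2) + σ / Real.sqrt r * (y q / (1 - q)) := by
    intro q hq
    have h := (((hasDerivAt_id q).const_sub 1).const_mul l).mul (hE q hq)
    have h2 := h.congr_of_eventuallyEq (Filter.eventuallyEq_of_mem (hnhds q hq) hUeq)
    rw [h2.deriv, hy' q hq, Real.exp_neg]
    have h1 := (hq1 q hq).ne'
    have he := (Real.exp_pos ((y q) ^ 2)).ne'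
    simp only [id]
    field_simp
  have hU'' : ∀ q ∈ Set.Ioo qstar p,
      deriv (deriv U) q = σ / Real.sqrt r * (deriv y q / (1 - q)) := by
    intro q hq
    have h1 := (hq1 q hq).ne'
    have h := ((hE q hq).const_mul (-l)).add
      (((hy1 q hq).hasDerivAt.div ((hasDerivAt_id q).const_sub 1) h1).const_mul
        (σ / Real.sqrt r))
    have h2 := h.congr_of_eventuallyEq (Filter.eventuallyEq_of_mem (hnhds q hq) hU')
    rw [h2.deriv, hy' q hq, Real.exp_neg]
    have he := (Real.exp_pos ((y q) ^ 2)).ne'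
    simp only [id]
    field_simp
    ring
  have hmem : ∀ᶠ q in nhdsWithin p (Set.Ioo qstar p), q ∈ Set.Ioo qstar p :=
    self_mem_nhdsWithin
  have hid : Filter.Tendsto (fun q : ℝ => q) (nhdsWithin p (Set.Ioo qstar p)) (nhds p) :=
    nhdsWithin_le_nhds
  have hylim : Filter.Tendsto y (nhdsWithin p (Set.Ioo qstar p)) (nhds 0) := by
    refine tendsto_zero_of_tendsto_erf ?_
    have h : Filter.Tendsto (fun q => c * (p - q) / (p * (1 - q)))
        (nhdsWithin p (Set.Ioo qstar p)) (nhds (c * (p - p) / (p * (1 - p)))) :=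
      ((hid.const_sub p).const_mul c).div ((hid.const_sub 1).const_mul p)
        (mul_pos hp0 hp1).ne'
    rw [sub_self, mul_zero, zero_div] at h
    refine h.congr' ?_
    filter_upwards [hmem] with q hq using (herf q hq).symm
  have hElim : Filter.Tendsto (fun q => Real.exp (-(y q) ^ 2))
      (nhdsWithin p (Set.Ioo qstar p)) (nhds 1) := by
    have h := ((hylim.pow 2).neg).rexp
    simpa using h
  refine ⟨fun q hq => ?_, ?_, ?_⟩
  · have hα' : α q = 2 * (1 - q) * σ * Real.sqrt r
        / ((Real.sqrt Real.pi * c * (1 - p) / p) * q) * Real.exp (-(y q) ^ 2) := by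
      have := (hq0 q hq).ne'
      rw [hα]
      field_simp
    have h0 := (hq0 q hq).ne'
    have h1 := (hq1 q hq).ne'
    have he := (Real.exp_pos ((y q) ^ 2)).ne'
    rw [hU'' q hq, hy' q hq, hUeq q hq, hα', hk, Real.exp_neg]
    field_simp
    rw [hsr2]
    ring
  · have h := ((hid.const_sub 1).const_mul l).mul hElim
    rw [mul_one] at h
    refine h.congr' ?_
    filter_upwards [hmem] with q hq using (hUeq q hq).symm
  · have h := (hElim.const_mul (-l)).add
      ((hylim.div (hid.const_sub 1) hp1.ne').const_mul (σ / Real.sqrt r))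
    rw [zero_div, mul_zero, add_zero, mul_one] at h
    refine h.congr' ?_
    filter_upwards [hmem] with q hq using (hU' q hq).symm
end
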